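/- Fix real numbers γₙ, γₑ ≥ 0 with γₙ + γₑ > 0 and κ ∈ ℝ. The fifteen 4×4 complex matrices X̂, Ŷ, Ẑ, K̂_X, K̂_Y, K̂_Z, K̂_XX, K̂_YY, K̂_ZZ, L̂_X, L̂_Y, L̂_Z, K̂_XY, K̂_YZ, K̂_ZX are linearly independent over ℝ and form a basis of su(4), the real Lie algebra of all 4×4 complex matrices A with Aᴴ = −A and trace A = 0 (which has real dimension 15). -/

import Mathlib

open Matrix Kronecker Complex

noncomputable section

/-- The 2×2 identity matrix 𝟙. -/
def m1 : Matrix (Fin 2) (Fin 2) ℂ := 1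
/-- The quaternion unit 𝐢 as a 2×2 complex matrix. -/
def mI : Matrix (Fin 2) (Fin 2) ℂ := !![0, Complex.I; Complex.I, 0]
/-- The quaternion unit 𝐣 as a 2×2 complex matrix. -/
def mJ : Matrix (Fin 2) (Fin 2) ℂ := !![0, -1; 1, 0]
/-- The quaternion unit 𝐤 as a 2×2 complex matrix. -/
def mK : Matrix (Fin 2) (Fin 2) ℂ := !![Complex.I, 0; 0, -Complex.I]

/-- K̂ = (i/2)(𝐢⊗𝐢 + 𝐣⊗𝐣 + 𝐤⊗𝐤). -/
def Khat : Matrix (Fin 2 × Fin 2) (Fin 2 × Fin 2) ℂ :=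
  (Complex.I / 2) • (mI ⊗ₖ mI + mJ ⊗ₖ mJ + mK ⊗ₖ mK)

/-- X̂₀ = (1/(γₙ+γₑ))(−γₙ·𝐢⊗𝟙 + γₑ·𝟙⊗𝐢). -/
def Xhat0 (γn γe : ℝ) : Matrix (Fin 2 × Fin 2) (Fin 2 × Fin 2) ℂ :=
  (γn + γe)⁻¹ • ((-γn) • (mI ⊗ₖ m1) + γe • (m1 ⊗ₖ mI))

/-- Ŷ₀ = (1/(γₙ+γₑ))(γₙ·𝐣⊗𝟙 − γₑ·𝟙⊗𝐣). -/
def Yhat0 (γn γe : ℝ) : Matrix (Fin 2 × Fin 2) (Fin 2 × Fin 2) ℂ :=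
  (γn + γe)⁻¹ • (γn • (mJ ⊗ₖ m1) + (-γe) • (m1 ⊗ₖ mJ))

/-- Ẑ₀ = (1/(γₙ+γₑ))(−γₙ·𝐤⊗𝟙 + γₑ·𝟙⊗𝐤). -/
def Zhat0 (γn γe : ℝ) : Matrix (Fin 2 × Fin 2) (Fin 2 × Fin 2) ℂ :=
  (γn + γe)⁻¹ • ((-γn) • (mK ⊗ₖ m1) + γe • (m1 ⊗ₖ mK))

/-- X̂ = X̂₀ + κ·K̂. -/
def Xhat (γn γe κ : ℝ) : Matrix (Fin 2 × Fin 2) (Fin 2 × Fin 2) ℂ := Xhat0 γn γe + κ • Khat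
/-- Ŷ = Ŷ₀ + κ·K̂. -/
def Yhat (γn γe κ : ℝ) : Matrix (Fin 2 × Fin 2) (Fin 2 × Fin 2) ℂ := Yhat0 γn γe + κ • Khat
/-- Ẑ = Ẑ₀ + κ·K̂. -/
def Zhat (γn γe κ : ℝ) : Matrix (Fin 2 × Fin 2) (Fin 2 × Fin 2) ℂ := Zhat0 γn γe + κ • Khat

/-- K̂_X = (i/2)(−𝐣⊗𝐤 + 𝐤⊗𝐣). -/
def KhatX : Matrix (Fin 2 × Fin 2) (Fin 2 × Fin 2) ℂ :=
  (Complex.I / 2) • (-(mJ ⊗ₖ mK) + mK ⊗ₖ mJ)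
/-- K̂_Y = (i/2)(𝐤⊗𝐢 − 𝐢⊗𝐤). -/
def KhatY : Matrix (Fin 2 × Fin 2) (Fin 2 × Fin 2) ℂ :=
  (Complex.I / 2) • (mK ⊗ₖ mI - mI ⊗ₖ mK)
/-- K̂_Z = (i/2)(−𝐢⊗𝐣 + 𝐣⊗𝐢). -/
def KhatZ : Matrix (Fin 2 × Fin 2) (Fin 2 × Fin 2) ℂ :=
  (Complex.I / 2) • (-(mI ⊗ₖ mJ) + mJ ⊗ₖ mI)
/-- K̂_XX = −(i/2)(𝐣⊗𝐣 + 𝐤⊗𝐤). -/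
def KhatXX : Matrix (Fin 2 × Fin 2) (Fin 2 × Fin 2) ℂ :=
  (-(Complex.I / 2)) • (mJ ⊗ₖ mJ + mK ⊗ₖ mK)
/-- K̂_YY = −(i/2)(𝐢⊗𝐢 + 𝐤⊗𝐤). -/
def KhatYY : Matrix (Fin 2 × Fin 2) (Fin 2 × Fin 2) ℂ :=
  (-(Complex.I / 2)) • (mI ⊗ₖ mI + mK ⊗ₖ mK)
/-- K̂_ZZ = −(i/2)(𝐢⊗𝐢 + 𝐣⊗𝐣). -/
def KhatZZ : Matrix (Fin 2 × Fin 2) (Fin 2 × Fin 2) ℂ :=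
  (-(Complex.I / 2)) • (mI ⊗ₖ mI + mJ ⊗ₖ mJ)
/-- L̂_X = −(1/4)(𝐢⊗𝟙 + 𝟙⊗𝐢). -/
def LhatX : Matrix (Fin 2 × Fin 2) (Fin 2 × Fin 2) ℂ :=
  (-(1 / 4 : ℝ)) • (mI ⊗ₖ m1 + m1 ⊗ₖ mI)
/-- L̂_Y = (1/4)(𝐣⊗𝟙 + 𝟙⊗𝐣). -/
def LhatY : Matrix (Fin 2 × Fin 2) (Fin 2 × Fin 2) ℂ :=
  ((1 / 4 : ℝ)) • (mJ ⊗ₖ m1 + m1 ⊗ₖ mJ)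
/-- L̂_Z = −(1/4)(𝐤⊗𝟙 + 𝟙⊗𝐤). -/
def LhatZ : Matrix (Fin 2 × Fin 2) (Fin 2 × Fin 2) ℂ :=
  (-(1 / 4 : ℝ)) • (mK ⊗ₖ m1 + m1 ⊗ₖ mK)
/-- X̂_KK = (1/2)(𝐢⊗𝟙 − 𝟙⊗𝐢). -/
def XhatKK : Matrix (Fin 2 × Fin 2) (Fin 2 × Fin 2) ℂ :=
  ((1 / 2 : ℝ)) • (mI ⊗ₖ m1 - m1 ⊗ₖ mI)
/-- Ŷ_KK = (1/2)(−𝐣⊗𝟙 + 𝟙⊗𝐣). -/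
def YhatKK : Matrix (Fin 2 × Fin 2) (Fin 2 × Fin 2) ℂ :=
  ((1 / 2 : ℝ)) • (-(mJ ⊗ₖ m1) + m1 ⊗ₖ mJ)
/-- Ẑ_KK = (1/2)(𝐤⊗𝟙 − 𝟙⊗𝐤). -/
def ZhatKK : Matrix (Fin 2 × Fin 2) (Fin 2 × Fin 2) ℂ :=
  ((1 / 2 : ℝ)) • (mK ⊗ₖ m1 - m1 ⊗ₖ mK)
/-- K̂_XY = −(i/(2(γₙ+γₑ)))(γₙ·𝐢⊗𝐣 + γₑ·𝐣⊗𝐢) − (κ/2)(𝐢⊗𝟙 − 𝟙⊗𝐢). -/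
def KhatXY (γn γe κ : ℝ) : Matrix (Fin 2 × Fin 2) (Fin 2 × Fin 2) ℂ :=
  (-(Complex.I / (2 * ((γn : ℂ) + (γe : ℂ))))) •
      ((γn : ℂ) • (mI ⊗ₖ mJ) + (γe : ℂ) • (mJ ⊗ₖ mI)) -
    (κ / 2 : ℝ) • (mI ⊗ₖ m1 - m1 ⊗ₖ mI)
/-- K̂_YZ = −(i/(2(γₙ+γₑ)))(γₙ·𝐣⊗𝐤 + γₑ·𝐤⊗𝐣) − (κ/2)(−𝐣⊗𝟙 + 𝟙⊗𝐣). -/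
def KhatYZ (γn γe κ : ℝ) : Matrix (Fin 2 × Fin 2) (Fin 2 × Fin 2) ℂ :=
  (-(Complex.I / (2 * ((γn : ℂ) + (γe : ℂ))))) •
      ((γn : ℂ) • (mJ ⊗ₖ mK) + (γe : ℂ) • (mK ⊗ₖ mJ)) -
    (κ / 2 : ℝ) • (-(mJ ⊗ₖ m1) + m1 ⊗ₖ mJ)
/-- K̂_ZX = (i/(2(γₙ+γₑ)))(γₙ·𝐤⊗𝐢 + γₑ·𝐢⊗𝐤) − (κ/2)(𝐤⊗𝟙 − 𝟙⊗𝐤). -/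
def KhatZX (γn γe κ : ℝ) : Matrix (Fin 2 × Fin 2) (Fin 2 × Fin 2) ℂ :=
  ((Complex.I / (2 * ((γn : ℂ) + (γe : ℂ))))) •
      ((γn : ℂ) • (mK ⊗ₖ mI) + (γe : ℂ) • (mI ⊗ₖ mK)) -
    (κ / 2 : ℝ) • (mK ⊗ₖ m1 - m1 ⊗ₖ mK)

/-- The real combination of `σ ⊗ 𝟙`, `𝟙 ⊗ σ` and `i σ ⊗ σ'` (`σ, σ'` quaternion units)
with coefficients `p`, `q` and `t`. -/
def quatComb (p q : Fin 3 → ℝ) (t : Fin 3 → Fin 3 → ℝ) :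
    Matrix (Fin 2 × Fin 2) (Fin 2 × Fin 2) ℂ :=
  p 0 • (mI ⊗ₖ m1) + p 1 • (mJ ⊗ₖ m1) + p 2 • (mK ⊗ₖ m1) +
  (q 0 • (m1 ⊗ₖ mI) + q 1 • (m1 ⊗ₖ mJ) + q 2 • (m1 ⊗ₖ mK)) +
  Complex.I • (t 0 0 • (mI ⊗ₖ mI) + t 0 1 • (mI ⊗ₖ mJ) + t 0 2 • (mI ⊗ₖ mK) +
    t 1 0 • (mJ ⊗ₖ mI) + t 1 1 • (mJ ⊗ₖ mJ) + t 1 2 • (mJ ⊗ₖ mK) +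
    t 2 0 • (mK ⊗ₖ mI) + t 2 1 • (mK ⊗ₖ mJ) + t 2 2 • (mK ⊗ₖ mK))

lemma conjTranspose_quatComb (p q : Fin 3 → ℝ) (t : Fin 3 → Fin 3 → ℝ) :
    (quatComb p q t)ᴴ = -quatComb p q t := by
  have hI : mIᴴ = -mI := by ext i j; fin_cases i <;> fin_cases j <;> simp [mI]
  have hJ : mJᴴ = -mJ := by ext i j; fin_cases i <;> fin_cases j <;> simp [mJ]
  have hK : mKᴴ = -mK := by ext i j; fin_cases i <;> fin_cases j <;> simp [mK]
  have h1 : m1ᴴ = m1 := conjTranspose_one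
  have hl (A B : Matrix (Fin 2) (Fin 2) ℂ) : (-A) ⊗ₖ B = -(A ⊗ₖ B) := by ext; simp
  have hr (A B : Matrix (Fin 2) (Fin 2) ℂ) : A ⊗ₖ (-B) = -(A ⊗ₖ B) := by ext; simp
  simp only [quatComb, conjTranspose_add, conjTranspose_smul, conjTranspose_kronecker, hI, hJ, hK,
    h1, hl, hr, star_trivial, Complex.star_def, Complex.conj_I]
  module

lemma trace_quatComb (p q : Fin 3 → ℝ) (t : Fin 3 → Fin 3 → ℝ) :
    (quatComb p q t).trace = 0 := by
  have hI : mI.trace = 0 := by simp [mI, trace_fin_two]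
  have hJ : mJ.trace = 0 := by simp [mJ, trace_fin_two]
  have hK : mK.trace = 0 := by simp [mK, trace_fin_two]
  simp [quatComb, trace_kronecker, hI, hJ, hK]

lemma eq_zero_of_quatComb_eq_zero {p q : Fin 3 → ℝ} {t : Fin 3 → Fin 3 → ℝ}
    (h : quatComb p q t = 0) : p = 0 ∧ q = 0 ∧ t = 0 := by
  have hre (i j) : (quatComb p q t i j).re = 0 := by simp [h]
  have him (i j) : (quatComb p q t i j).im = 0 := by simp [h]
  simp only [Prod.forall, Fin.forall_fin_two] at hre him
  obtain ⟨⟨⟨⟨r1, r2⟩, r3, r4⟩, ⟨r5, r6⟩, r7, r8⟩,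
    ⟨⟨r9, r10⟩, r11, r12⟩, ⟨r13, r14⟩, r15, r16⟩ := hre
  obtain ⟨⟨⟨⟨i1, i2⟩, i3, i4⟩, ⟨i5, i6⟩, i7, i8⟩,
    ⟨⟨i9, i10⟩, i11, i12⟩, ⟨i13, i14⟩, i15, i16⟩ := him
  clear r1 r5 r6 r9 r10 r11 r13 r14 r15 r16 i5 i9 i10 i13 i14 i15
  simp [quatComb, mI, mJ, mK, m1, kroneckerMap_apply] at r2 r3 r4 r7 r8 r12
  simp [quatComb, mI, mJ, mK, m1, kroneckerMap_apply] at i1 i2 i3 i4 i6 i7 i8 i11 i12 i16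
  refine ⟨funext fun i => ?_, funext fun i => ?_, funext fun i => funext fun j => ?_⟩
  · fin_cases i <;> simp <;> linarith
  · fin_cases i <;> simp <;> linarith
  · fin_cases i <;> fin_cases j <;> simp <;> linarith

lemma exists_quatComb_eq {A : Matrix (Fin 2 × Fin 2) (Fin 2 × Fin 2) ℂ} (hA : Aᴴ = -A)
    (htr : A.trace = 0) : ∃ p q t, quatComb p q t = A := by
  have hre (i j) : (A j i).re = -(A i j).re := by simpa using congrArg Complex.re (congrFun₂ hA i j)
  have him (i j) : (A j i).im = (A i j).im := by simpa using congrArg Complex.im (congrFun₂ hA i j)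
  have hdiag (i) : (A i i).re = 0 := by linarith [hre i i]
  have hlast : (A (1, 1) (1, 1)).im =
      -((A (0, 0) (0, 0)).im + (A (0, 1) (0, 1)).im + (A (1, 0) (1, 0)).im) := by
    have := congrArg Complex.im htr
    simp [trace, Fintype.sum_prod_type] at this
    linarith
  obtain ⟨a, ha⟩ : ∃ a, a = A (0, 0) (0, 1) := ⟨_, rfl⟩
  obtain ⟨b, hb⟩ : ∃ b, b = A (0, 0) (1, 0) := ⟨_, rfl⟩
  obtain ⟨c, hc⟩ : ∃ c, c = A (0, 0) (1, 1) := ⟨_, rfl⟩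
  obtain ⟨d, hd⟩ : ∃ d, d = A (0, 1) (1, 0) := ⟨_, rfl⟩
  obtain ⟨f, hf⟩ : ∃ f, f = A (0, 1) (1, 1) := ⟨_, rfl⟩
  obtain ⟨g, hg⟩ : ∃ g, g = A (1, 0) (1, 1) := ⟨_, rfl⟩
  obtain ⟨x, hx⟩ : ∃ x, x = (A (0, 0) (0, 0)).im := ⟨_, rfl⟩
  obtain ⟨y, hy⟩ : ∃ y, y = (A (0, 1) (0, 1)).im := ⟨_, rfl⟩
  obtain ⟨z, hz⟩ : ∃ z, z = (A (1, 0) (1, 0)).im := ⟨_, rfl⟩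
  refine ⟨![(b.im + f.im) / 2, -(b.re + f.re) / 2, (x + y) / 2],
    ![(a.im + g.im) / 2, -(a.re + g.re) / 2, (x + z) / 2],
    ![![-(c.im + d.im) / 2, (c.re - d.re) / 2, (f.im - b.im) / 2],
      ![(c.re + d.re) / 2, (c.im - d.im) / 2, (b.re - f.re) / 2],
      ![(g.im - a.im) / 2, (a.re - g.re) / 2, (y + z) / 2]], ?_⟩
  ext ⟨i, j⟩ ⟨k, l⟩
  fin_cases i <;> fin_cases j <;> fin_cases k <;> fin_cases l <;> apply Complex.ext <;>
    simp [quatComb, mI, mJ, mK, m1, kroneckerMap_apply, hdiag, hlast, ← ha, ← hb, ← hc, ← hd,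
      ← hf, ← hg, ← hx, ← hy, ← hz, hre (0, 0) (0, 1), hre (0, 0) (1, 0), hre (0, 0) (1, 1),
      hre (0, 1) (1, 0), hre (0, 1) (1, 1), hre (1, 0) (1, 1), him (0, 0) (0, 1),
      him (0, 0) (1, 0), him (0, 0) (1, 1), him (0, 1) (1, 0), him (0, 1) (1, 1),
      him (1, 0) (1, 1)] <;>
    ring

lemma sum_smul_eq_quatComb {γn γe : ℝ} (κ : ℝ) (hsum : 0 < γn + γe) (g : Fin 15 → ℝ) :
    ∑ i, g i • (![Xhat γn γe κ, Yhat γn γe κ, Zhat γn γe κ, KhatX, KhatY, KhatZ,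
        KhatXX, KhatYY, KhatZZ, LhatX, LhatY, LhatZ,
        KhatXY γn γe κ, KhatYZ γn γe κ, KhatZX γn γe κ] i) =
      quatComb
        ![-(γn / (γn + γe)) * g 0 - g 9 / 4 - κ / 2 * g 12,
          γn / (γn + γe) * g 1 + g 10 / 4 + κ / 2 * g 13,
          -(γn / (γn + γe)) * g 2 - g 11 / 4 - κ / 2 * g 14]
        ![γe / (γn + γe) * g 0 - g 9 / 4 + κ / 2 * g 12,
          -(γe / (γn + γe)) * g 1 + g 10 / 4 - κ / 2 * g 13,
          γe / (γn + γe) * g 2 - g 11 / 4 + κ / 2 * g 14]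
        ![![κ / 2 * (g 0 + g 1 + g 2) - (g 7 + g 8) / 2,
            -(g 5) / 2 - γn / (γn + γe) * g 12 / 2,
            -(g 4) / 2 + γe / (γn + γe) * g 14 / 2],
          ![g 5 / 2 - γe / (γn + γe) * g 12 / 2,
            κ / 2 * (g 0 + g 1 + g 2) - (g 6 + g 8) / 2,
            -(g 3) / 2 - γn / (γn + γe) * g 13 / 2],
          ![g 4 / 2 + γn / (γn + γe) * g 14 / 2,
            g 3 / 2 - γe / (γn + γe) * g 13 / 2,
            κ / 2 * (g 0 + g 1 + g 2) - (g 6 + g 7) / 2]] := by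
  have hs : (γn : ℂ) + γe ≠ 0 := by exact_mod_cast hsum.ne'
  simp [Fin.sum_univ_succ, quatComb, Xhat, Yhat, Zhat, Xhat0, Yhat0, Zhat0, Khat,
    KhatX, KhatY, KhatZ, KhatXX, KhatYY, KhatZZ, LhatX, LhatY, LhatZ, KhatXY, KhatYZ, KhatZX]
  match_scalars <;> simp <;> field_simp <;> ring

/-- the fifteen matrices X̂, Ŷ, Ẑ, K̂_X, K̂_Y, K̂_Z, K̂_XX, K̂_YY, K̂_ZZ,
L̂_X, L̂_Y, L̂_Z, K̂_XY, K̂_YZ, K̂_ZX are linearly independent over ℝ and form a basis of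
su(4) (they span the traceless skew-Hermitian 4×4 matrices, of real dimension 15). -/
theorem stmt11 (γn γe κ : ℝ) (hn : 0 ≤ γn) (he : 0 ≤ γe) (hsum : 0 < γn + γe) :
    LinearIndependent ℝ
      ![Xhat γn γe κ, Yhat γn γe κ, Zhat γn γe κ, KhatX, KhatY, KhatZ,
        KhatXX, KhatYY, KhatZZ, LhatX, LhatY, LhatZ,
        KhatXY γn γe κ, KhatYZ γn γe κ, KhatZX γn γe κ] ∧
    ((Submodule.span ℝ
        (Set.range
          ![Xhat γn γe κ, Yhat γn γe κ, Zhat γn γe κ, KhatX, KhatY, KhatZ,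
            KhatXX, KhatYY, KhatZZ, LhatX, LhatY, LhatZ,
            KhatXY γn γe κ, KhatYZ γn γe κ, KhatZX γn γe κ])) : Set _) =
      {A : Matrix (Fin 2 × Fin 2) (Fin 2 × Fin 2) ℂ | Aᴴ = -A ∧ Matrix.trace A = 0} := by
  set v := ![Xhat γn γe κ, Yhat γn γe κ, Zhat γn γe κ, KhatX, KhatY, KhatZ,
    KhatXX, KhatYY, KhatZZ, LhatX, LhatY, LhatZ,
    KhatXY γn γe κ, KhatYZ γn γe κ, KhatZX γn γe κ]
  have hv (g : Fin 15 → ℝ) := sum_smul_eq_quatComb κ hsum g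
  have hab : γn / (γn + γe) + γe / (γn + γe) = 1 := by field_simp
  generalize γn / (γn + γe) = a at hv hab
  generalize γe / (γn + γe) = b at hv hab
  obtain rfl : a = 1 - b := by linarith
  constructor
  · rw [Fintype.linearIndependent_iff]
    intro g hg
    obtain ⟨hp, hq, ht⟩ := eq_zero_of_quatComb_eq_zero ((hv g).symm.trans hg)
    have p0 := congrFun hp 0
    have p1 := congrFun hp 1
    have p2 := congrFun hp 2
    have q0 := congrFun hq 0
    have q1 := congrFun hq 1
    have q2 := congrFun hq 2
    have t00 := congrFun₂ ht 0 0
    have t01 := congrFun₂ ht 0 1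
    have t02 := congrFun₂ ht 0 2
    have t10 := congrFun₂ ht 1 0
    have t11 := congrFun₂ ht 1 1
    have t12 := congrFun₂ ht 1 2
    have t20 := congrFun₂ ht 2 0
    have t21 := congrFun₂ ht 2 1
    have t22 := congrFun₂ ht 2 2
    simp at p0 p1 p2 q0 q1 q2 t00 t01 t02 t10 t11 t12 t20 t21 t22
    have g12 : g 12 = 0 := by linear_combination -2 * (t01 + t10)
    have g13 : g 13 = 0 := by linear_combination -2 * (t12 + t21)
    have g14 : g 14 = 0 := by linear_combination 2 * (t20 + t02)
    rw [g12] at t10 p0 q0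
    rw [g13] at t21 p1 q1
    rw [g14] at t02 p2 q2
    have g0 : g 0 = 0 := by linear_combination q0 - p0
    have g1 : g 1 = 0 := by linear_combination p1 - q1
    have g2 : g 2 = 0 := by linear_combination q2 - p2
    rw [g0] at q0
    rw [g1] at q1
    rw [g2] at q2
    rw [g0, g1, g2] at t00 t11 t22
    intro i
    fin_cases i <;> simp only [Fin.reduceFinMk, Fin.zero_eta, Fin.mk_one, Fin.isValue] <;> linarith
  · ext A
    rw [SetLike.mem_coe, Submodule.mem_span_range_iff_exists_fun, Set.mem_ofPred_eq]
    constructor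
    · rintro ⟨g, rfl⟩
      rw [hv]
      exact ⟨conjTranspose_quatComb _ _ _, trace_quatComb _ _ _⟩
    · rintro ⟨hA, htr⟩
      obtain ⟨p, q, t, rfl⟩ := exists_quatComb_eq hA htr
      let xy := -2 * (t 0 1 + t 1 0)
      let yz := -2 * (t 1 2 + t 2 1)
      let zx := 2 * (t 2 0 + t 0 2)
      let x := q 0 - p 0 - κ * xy
      let y := p 1 - q 1 - κ * yz
      let z := q 2 - p 2 - κ * zx
      let w := κ * (x + y + z) / 2
      refine ⟨![x, y, z, 2 * t 2 1 + b * yz, b * zx - 2 * t 0 2, 2 * t 1 0 + b * xy,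
        w - t 1 1 - t 2 2 + t 0 0, w - t 0 0 - t 2 2 + t 1 1, w - t 0 0 - t 1 1 + t 2 2,
        4 * (b * x + κ / 2 * xy - q 0), 4 * (q 1 + b * y + κ / 2 * yz),
        4 * (b * z + κ / 2 * zx - q 2), xy, yz, zx], (hv _).trans ?_⟩
      congr 1
      · ext i
        fin_cases i <;> simp [x, y, z, xy, yz, zx] <;> ring
      · ext i
        fin_cases i <;> simp <;> ring
      · ext i j
        fin_cases i <;> fin_cases j <;> simp [w, xy, yz, zx] <;> ring
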